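/- arXiv:1205.0864 — 6 statements merged into one kernel-verified Lean document; each statement's English description precedes it below -/
import Mathlib

section
/- For every compact Hausdorff space X, the set I(X) of all idempotent probability measures on X is a compact subspace of the product space ℝ^{C(X,ℝ)} equipped with the topology of pointwise convergence. -/
/-- An idempotent probability measure on a topological space `X`. -/
def IsIdempotentProbMeasure {X : Type*} [TopologicalSpace X] (μ : C(X, ℝ) → ℝ) : Prop :=
  (∀ c : ℝ, μ (ContinuousMap.const X c) = c) ∧
  (∀ (φ : C(X, ℝ)) (c : ℝ), μ (φ + ContinuousMap.const X c) = μ φ + c) ∧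
  (∀ φ ψ : C(X, ℝ), μ (φ ⊔ ψ) = max (μ φ) (μ ψ))

namespace IsIdempotentProbMeasure

variable {X : Type*} [TopologicalSpace X] {μ : C(X, ℝ) → ℝ}

theorem monotone (hμ : IsIdempotentProbMeasure μ) : Monotone μ := fun φ ψ h => by
  have h_max := hμ.2.2 φ ψ
  rw [sup_eq_right.mpr h] at h_max
  exact h_max ▸ le_max_left _ _

theorem mem_Icc_norm [CompactSpace X] (hμ : IsIdempotentProbMeasure μ) (φ : C(X, ℝ)) :
    μ φ ∈ Set.Icc (-‖φ‖) ‖φ‖ := by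
  constructor
  · rw [← hμ.1 (-‖φ‖)]
    exact hμ.monotone fun x => φ.neg_norm_le_apply x
  · rw [← hμ.1 ‖φ‖]
    exact hμ.monotone fun x => φ.apply_le_norm x

end IsIdempotentProbMeasure

theorem isClosed_idempotentProbMeasures {X : Type*} [TopologicalSpace X] :
    IsClosed {μ : C(X, ℝ) → ℝ | IsIdempotentProbMeasure μ} := by
  simp only [IsIdempotentProbMeasure, Set.ofPred_and, Set.ofPred_forall]
  refine (isClosed_iInter fun c => ?_).inter
    ((isClosed_iInter fun φ => isClosed_iInter fun c => ?_).inter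
      (isClosed_iInter fun φ => isClosed_iInter fun ψ => ?_)) <;>
  exact isClosed_eq (by fun_prop) (by fun_prop)

/-- For every compact Hausdorff space `X`, the set `I(X)` of all idempotent probability
measures on `X` is a compact subset of the product space `ℝ^{C(X,ℝ)}` with the topology of
pointwise convergence. -/
theorem isCompact_idempotentProbMeasures {X : Type*} [TopologicalSpace X] [CompactSpace X]
    [T2Space X] :
    IsCompact {μ : C(X, ℝ) → ℝ | IsIdempotentProbMeasure μ} := by
  have h_box : IsCompact (Set.univ.pi fun φ : C(X, ℝ) => Set.Icc (-‖φ‖) ‖φ‖) :=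
    isCompact_univ_pi fun _ => isCompact_Icc
  exact h_box.of_isClosed_subset isClosed_idempotentProbMeasures
    fun _ hμ φ _ => hμ.mem_Icc_norm φ
end

section
/- Uniqueness of the representation of finite-support idempotent probability measures: let X be a compact Hausdorff space, x_1, …, x_k ∈ X pairwise distinct with weights λ_1, …, λ_k ∈ ℝ (max_i λ_i = 0), and y_1, …, y_m ∈ X pairwise distinct with weights κ_1, …, κ_m ∈ ℝ (max_j κ_j = 0). If max_{1≤i≤k} (λ_i + φ(x_i)) = max_{1≤j≤m} (κ_j + φ(y_j)) for every φ ∈ C(X,ℝ), then k = m and the sets of pairs {(x_i, λ_i) : 1 ≤ i ≤ k} and {(y_j, κ_j) : 1 ≤ j ≤ m} coincide. -/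
/-- If one max-plus combination of Dirac functionals dominated by another one charges a point,
then so does the dominating one, with at least the same weight. -/
theorem exists_eq_and_weight_le_of_iSup_le {X ι κ : Type*} [TopologicalSpace X] [NormalSpace X]
    [T1Space X] [Finite ι] [Finite κ] [Nonempty κ]
    {x : ι → X} {a : ι → ℝ} {y : κ → X} {b : κ → ℝ}
    (h : ∀ φ : C(X, ℝ), (⨆ i, (a i + φ (x i))) ≤ ⨆ j, (b j + φ (y j))) (i : ι) :
    ∃ j, y j = x i ∧ a i ≤ b j := by
  obtain ⟨B, hB⟩ := (Set.finite_range b).bddAbove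
  obtain ⟨f, hf₀, hf₁, -⟩ := exists_continuous_zero_one_of_isClosed
    (isClosed_singleton (x := x i)) ((Set.finite_range y).subset Set.sdiff_subset).isClosed
    (Set.disjoint_sdiff_right (s := {x i}) (t := Set.range y))
  have hfx : f (x i) = 0 := hf₀ rfl
  -- A function vanishing at `x i` and very negative at all other points of the range of `y`.
  let φ : C(X, ℝ) := (-(B - a i + 1)) • f
  obtain ⟨j, hj⟩ := exists_eq_ciSup_of_finite (f := fun j => b j + φ (y j))
  have hle : a i + φ (x i) ≤ b j + φ (y j) :=
    (le_ciSup (Set.finite_range fun i => a i + φ (x i)).bddAbove i).trans ((h φ).trans hj.ge)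
  simp only [φ, ContinuousMap.smul_apply, smul_eq_mul, hfx, mul_zero, add_zero] at hle
  have hyx : y j = x i := by
    by_contra hne
    have hfy : f (y j) = 1 := hf₁ ⟨⟨j, rfl⟩, hne⟩
    have hbB : b j ≤ B := hB ⟨j, rfl⟩
    rw [hfy] at hle
    linarith
  refine ⟨j, hyx, ?_⟩
  simpa [hyx, hfx] using hle

/-- If two max-plus combinations of Dirac functionals agree and the first one has pairwise
distinct points, then each weighted point of the first occurs in the second. -/
theorem range_subset_range_of_iSup_eq {X ι κ : Type*} [TopologicalSpace X] [NormalSpace X]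
    [T1Space X] [Finite ι] [Finite κ] [Nonempty ι] [Nonempty κ]
    {x : ι → X} (hx : Function.Injective x) {a : ι → ℝ} {y : κ → X} {b : κ → ℝ}
    (h : ∀ φ : C(X, ℝ), (⨆ i, (a i + φ (x i))) = ⨆ j, (b j + φ (y j))) :
    (Set.range fun i => (x i, a i)) ⊆ Set.range fun j => (y j, b j) := by
  rintro _ ⟨i, rfl⟩
  obtain ⟨j, hyx, hab⟩ := exists_eq_and_weight_le_of_iSup_le (fun φ => (h φ).le) i
  obtain ⟨i', hxy, hba⟩ := exists_eq_and_weight_le_of_iSup_le (fun φ => (h φ).ge) j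
  obtain rfl : i' = i := hx (hxy.trans hyx)
  exact ⟨j, Prod.ext hyx (hba.antisymm hab)⟩

/-- Uniqueness of the representation of finite-support idempotent probability measures:
if `max_i (λ_i + φ(x_i)) = max_j (κ_j + φ(y_j))` for all `φ ∈ C(X,ℝ)`, where the `x_i`
are pairwise distinct, the `y_j` are pairwise distinct, and `max_i λ_i = max_j κ_j = 0`,
then `k = m` and the sets of pairs `{(x_i, λ_i)}` and `{(y_j, κ_j)}` coincide. -/
theorem finSupport_repr_unique {X : Type*} [TopologicalSpace X] [CompactSpace X] [T2Space X]
    {k m : ℕ} (hk : 0 < k) (hm : 0 < m)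
    (x : Fin k → X) (hx : Function.Injective x)
    (lam : Fin k → ℝ) (hlam : (⨆ i, lam i) = 0)
    (y : Fin m → X) (hy : Function.Injective y)
    (kap : Fin m → ℝ) (hkap : (⨆ j, kap j) = 0)
    (h : ∀ φ : C(X, ℝ), (⨆ i, (lam i + φ (x i))) = ⨆ j, (kap j + φ (y j))) :
    k = m ∧ (Set.range fun i => (x i, lam i)) = (Set.range fun j => (y j, kap j)) := by
  have : Nonempty (Fin k) := ⟨⟨0, hk⟩⟩
  have : Nonempty (Fin m) := ⟨⟨0, hm⟩⟩
  have hrange : (Set.range fun i => (x i, lam i)) = Set.range fun j => (y j, kap j) :=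
    (range_subset_range_of_iSup_eq hx h).antisymm
      (range_subset_range_of_iSup_eq hy fun φ => (h φ).symm)
  refine ⟨?_, hrange⟩
  have hxl : Function.Injective fun i => (x i, lam i) := fun _ _ e => hx (Prod.ext_iff.1 e).1
  have hyk : Function.Injective fun j => (y j, kap j) := fun _ _ e => hy (Prod.ext_iff.1 e).1
  simpa [Nat.card_range_of_injective hxl,
    Nat.card_range_of_injective hyk] using congrArg (fun s : Set (X × ℝ) => Nat.card s) hrange
end

section
/- Let X be a compact Hausdorff space. For each φ ∈ C(X,ℝ), the function φ̄ : I(X) → ℝ defined by φ̄(μ) = μ(φ) is continuous on the compact Hausdorff space I(X) (with the pointwise convergence topology); and for every idempotent probability measure M on I(X), the functional ψ_X(M) : C(X,ℝ) → ℝ defined by ψ_X(M)(φ) = M(φ̄) is an idempotent probability measure on X. -/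
/-- The space `I(X)` of idempotent probability measures with the pointwise topology. -/
abbrev IPM (X : Type*) [TopologicalSpace X] : Type _ :=
  {μ : C(X, ℝ) → ℝ // IsIdempotentProbMeasure μ}

/-- The map `φ̄ : I(X) → ℝ`, `φ̄(μ) = μ(φ)`, bundled as a continuous map. -/
def barEval {X : Type*} [TopologicalSpace X] (φ : C(X, ℝ)) : C(IPM X, ℝ) :=
  ⟨fun μ => μ.1 φ, (continuous_apply φ).comp continuous_subtype_val⟩

/-- For each `φ ∈ C(X,ℝ)` the function `φ̄ : I(X) → ℝ`, `φ̄(μ) = μ(φ)`, is continuous; and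
for every idempotent probability measure `M` on `I(X)`, the barycenter functional
`ψ_X(M) : φ ↦ M(φ̄)` is an idempotent probability measure on `X`. -/
theorem barycenter_isIdempotentProbMeasure {X : Type*} [TopologicalSpace X] [CompactSpace X]
    [T2Space X] :
    (∀ φ : C(X, ℝ), Continuous (fun μ : IPM X => μ.1 φ)) ∧
    (∀ M : C(IPM X, ℝ) → ℝ, IsIdempotentProbMeasure M →
      IsIdempotentProbMeasure (fun φ : C(X, ℝ) => M (barEval φ))) := by
  refine ⟨fun φ => (barEval φ).continuous, fun M hM => ⟨fun c => ?_, fun φ c => ?_, fun φ ψ => ?_⟩⟩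
  · exact (congrArg M (ContinuousMap.ext fun μ => μ.2.1 c)).trans (hM.1 c)
  · rw [← hM.2.1 (barEval φ) c]
    exact congrArg M (ContinuousMap.ext fun μ => μ.2.2.1 φ c)
  · rw [← hM.2.2 (barEval φ) (barEval ψ)]
    exact congrArg M (ContinuousMap.ext fun μ => μ.2.2.2 φ ψ)
end

section
/- Existence of couplings: let X be a compact Hausdorff space and μ_1 = ⊕_{j=1}^{n} λ_j ⊙ δ_{x_j}, μ_2 = ⊕_{k=1}^{m} κ_k ⊙ δ_{y_k} finite-support idempotent probability measures on X. Then the functional ξ : C(X×X,ℝ) → ℝ defined by ξ(φ) = max_{j,k} (λ_j + κ_k + φ(x_j, y_k)) is an idempotent probability measure on X×X whose marginals are μ_1 and μ_2, i.e. I(π_1)(ξ) = μ_1 and I(π_2)(ξ) = μ_2, where π_1, π_2 : X×X → X are the coordinate projections. In particular the set Λ(μ_1, μ_2) = {ξ ∈ I(X×X) : I(π_1)(ξ) = μ_1, I(π_2)(ξ) = μ_2} is nonempty. -/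
theorem ciSup_sup_ciSup_of_finite {ι α : Type*} [Finite ι] [Nonempty ι]
    [ConditionallyCompleteLattice α] (f g : ι → α) :
    (⨆ i, f i ⊔ g i) = (⨆ i, f i) ⊔ ⨆ i, g i :=
  le_antisymm
    (ciSup_le fun i => sup_le_sup (le_ciSup (Set.finite_range f).bddAbove i)
      (le_ciSup (Set.finite_range g).bddAbove i))
    (sup_le (ciSup_mono (Set.finite_range _).bddAbove fun _ => le_sup_left)
      (ciSup_mono (Set.finite_range _).bddAbove fun _ => le_sup_right))

theorem Real.ciSup_add_of_finite {ι : Type*} [Finite ι] [Nonempty ι] (f : ι → ℝ) (c : ℝ) :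
    (⨆ i, (f i + c)) = (⨆ i, f i) + c :=
  (ciSup_add (Set.finite_range f).bddAbove c).symm

/-- Existence of couplings: for finite-support idempotent probability measures
`μ_1 = ⊕_j λ_j ⊙ δ_{x_j}` and `μ_2 = ⊕_k κ_k ⊙ δ_{y_k}` on `X`, the functional
`ξ(φ) = max_{j,k} (λ_j + κ_k + φ(x_j, y_k))` is an idempotent probability measure on
`X × X` whose marginals are `μ_1` and `μ_2`; in particular `Λ(μ_1, μ_2) ≠ ∅`. -/
theorem coupling_exists {X : Type*} [TopologicalSpace X] [CompactSpace X] [T2Space X]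
    {n m : ℕ} (hn : 0 < n) (hm : 0 < m)
    (x : Fin n → X) (lam : Fin n → ℝ) (hlam : (⨆ j, lam j) = 0)
    (y : Fin m → X) (kap : Fin m → ℝ) (hkap : (⨆ k, kap k) = 0) :
    IsIdempotentProbMeasure
        (fun φ : C(X × X, ℝ) => ⨆ j, ⨆ k, (lam j + kap k + φ (x j, y k))) ∧
    (∀ φ : C(X, ℝ),
      (fun ψ : C(X × X, ℝ) => ⨆ j, ⨆ k, (lam j + kap k + ψ (x j, y k)))
          (φ.comp ContinuousMap.fst)
        = ⨆ j, (lam j + φ (x j))) ∧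
    (∀ φ : C(X, ℝ),
      (fun ψ : C(X × X, ℝ) => ⨆ j, ⨆ k, (lam j + kap k + ψ (x j, y k)))
          (φ.comp ContinuousMap.snd)
        = ⨆ k, (kap k + φ (y k))) := by
  have : Nonempty (Fin n) := ⟨⟨0, hn⟩⟩
  have : Nonempty (Fin m) := ⟨⟨0, hm⟩⟩
  refine ⟨⟨fun c => ?_, fun φ c => ?_, fun φ ψ => ?_⟩, fun φ => ?_, fun φ => ?_⟩
  · have h (j : Fin n) (k : Fin m) : lam j + kap k + c = kap k + (lam j + c) := by ring
    simp [h, Real.ciSup_add_of_finite, hlam, hkap]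
  · simp [← add_assoc, Real.ciSup_add_of_finite]
  · simp [← max_add_add_left, ciSup_sup_ciSup_of_finite]
  · have h (j : Fin n) (k : Fin m) :
        lam j + kap k + φ (x j) = kap k + (lam j + φ (x j)) := by ring
    simp [h, Real.ciSup_add_of_finite, hkap]
  · have h (j : Fin n) (k : Fin m) :
        lam j + kap k + φ (y k) = (kap k + φ (y k)) + lam j := by ring
    have h' (j : Fin n) : (⨆ k, (kap k + φ (y k))) + lam j =
        lam j + ⨆ k, (kap k + φ (y k)) := add_comm _ _
    simp only [ContinuousMap.comp_apply, ContinuousMap.snd_apply, h, h',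
      Real.ciSup_add_of_finite, hlam, zero_add]
end

section
/- Uniqueness of the coupling with a Dirac measure: let X be a compact Hausdorff space, x_0 ∈ X, and μ = ⊕_{i=1}^{k} λ_i ⊙ δ_{x_i} a finite-support idempotent probability measure on X with pairwise distinct points x_i. If ξ is a finite-support idempotent probability measure on X×X with marginals I(π_1)(ξ) = μ and I(π_2)(ξ) = δ_{x_0}, then ξ = μ ⊗ δ_{x_0}, i.e. ξ(φ) = max_{1≤i≤k} (λ_i + φ(x_i, x_0)) for every φ ∈ C(X×X,ℝ). -/
/-- Separation of points by continuous functions with prescribed value at one of them. -/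
lemma exists_continuousMap_eq_zero_eq {Y : Type*} [TopologicalSpace Y] [CompactSpace Y]
    [T2Space Y] {a b : Y} (hab : a ≠ b) (r : ℝ) : ∃ f : C(Y, ℝ), f a = 0 ∧ f b = r := by
  obtain ⟨f, hf0, hf1, -⟩ := exists_continuous_zero_one_of_isClosed
    (isClosed_singleton (x := a)) (isClosed_singleton (x := b)) (by simpa using hab)
  have ha : f a = 0 := hf0 rfl
  have hb : f b = 1 := hf1 rfl
  exact ⟨r • f, by simp [ha], by simp [hb]⟩

/-- Uniqueness of the coupling with a Dirac measure: if `ξ` is a finite-support idempotent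
probability measure on `X × X` with marginals `I(π_1)(ξ) = μ = ⊕_i λ_i ⊙ δ_{x_i}` (the
`x_i` pairwise distinct) and `I(π_2)(ξ) = δ_{x_0}`, then `ξ = μ ⊗ δ_{x_0}`, that is,
`ξ(φ) = max_i (λ_i + φ(x_i, x_0))` for every `φ ∈ C(X×X, ℝ)`. -/
theorem coupling_with_dirac_unique {X : Type*} [TopologicalSpace X] [CompactSpace X]
    [T2Space X] (x0 : X) {k : ℕ} (hk : 0 < k)
    (x : Fin k → X) (hx : Function.Injective x)
    (lam : Fin k → ℝ) (hlam : (⨆ i, lam i) = 0)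
    (ξ : C(X × X, ℝ) → ℝ)
    (hξ : IsIdempotentProbMeasure ξ)
    (hfs : ∃ (s : ℕ) (_ : 0 < s) (z : Fin s → X × X) (c : Fin s → ℝ),
      (⨆ i, c i) = 0 ∧ ∀ φ : C(X × X, ℝ), ξ φ = ⨆ i, (c i + φ (z i)))
    (hm1 : ∀ φ : C(X, ℝ), ξ (φ.comp ContinuousMap.fst) = ⨆ i, (lam i + φ (x i)))
    (hm2 : ∀ φ : C(X, ℝ), ξ (φ.comp ContinuousMap.snd) = φ x0) :
    ∀ φ : C(X × X, ℝ), ξ φ = ⨆ i, (lam i + φ (x i, x0)) := by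
  obtain ⟨s, -, z, c, -, hξz⟩ := hfs
  have hz : ∀ i, (z i).2 = x0 := by
    intro i
    by_contra hne
    obtain ⟨f, hf0, hf1⟩ := exists_continuousMap_eq_zero_eq (Ne.symm hne) (1 - c i)
    have hsup : (⨆ j, (c j + f (z j).2)) = 0 := by
      rw [← hf0, ← hm2 f, hξz]
      rfl
    have hle := le_ciSup (Set.finite_range fun j => c j + f (z j).2).bddAbove i
    simp only [hsup, hf1] at hle
    linarith
  intro φ
  let ψ : C(X, ℝ) := φ.comp ((ContinuousMap.id X).prodMk (ContinuousMap.const X x0))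
  have hψ : ∀ i, φ (z i) = ψ (z i).1 := fun i => congrArg φ (Prod.ext rfl (hz i))
  calc ξ φ = ξ (ψ.comp ContinuousMap.fst) := by
        rw [hξz, hξz]
        exact iSup_congr fun i => congrArg (c i + ·) (hψ i)
    _ = ⨆ i, (lam i + φ (x i, x0)) := hm1 ψ
end

section
/- Lemma 3 (concrete form): let (X,ρ) be a compact metric space with D = diam X and ε > 0. Let μ = ⊕_{l=1}^{n} λ_l ⊙ δ_{x_l} be a finite-support idempotent probability measure on X (max_l λ_l = 0) such that min(D, max_{1≤l≤n} (|λ_l| + ρ(x_l, y))) ≥ ε for every y ∈ X (i.e. ρ_I(μ, η_X(X)) ≥ ε). Then for every finite family y_1, …, y_s ∈ X and α_1, …, α_s ∈ ℝ with max_i α_i = 0, one has min(D, max_{1≤l≤n} (|λ_l| + min(D, max_{1≤i≤s} (|α_i| + ρ(x_l, y_i))))) ≥ ε. (The left-hand side equals ρ_{I²}(I(η_X)(μ), δ_ν) for ν = ⊕_i α_i ⊙ δ_{y_i}, so this states that ρ_I(μ, η_X(X)) ≥ ε implies ρ_{I²}(I(η_X)(μ), η_{I(X)}(I(X))) ≥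 ε on finite-support measures.) -/
/-- Lemma 3 (concrete form): let `(X,ρ)` be a compact metric space, `D = diam X`,
`ε > 0`, and `μ = ⊕_l λ_l ⊙ δ_{x_l}` a finite-support idempotent probability measure with
`ρ_I(μ, η_X(X)) ≥ ε`, i.e. `min(D, max_l (|λ_l| + ρ(x_l, y))) ≥ ε` for every `y ∈ X`.
Then for every finite-support measure `ν = ⊕_i α_i ⊙ δ_{y_i}` (with `max_i α_i = 0`) one
has `ρ_{I²}(I(η_X)(μ), δ_ν) ≥ ε`, explicitly:
`min(D, max_l (|λ_l| + min(D, max_i (|α_i| + ρ(x_l, y_i))))) ≥ ε`. -/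
theorem lemma3_concrete {X : Type*} [MetricSpace X] [CompactSpace X]
    (D : ℝ) (hD : D = Metric.diam (Set.univ : Set X))
    (ε : ℝ) (hε : 0 < ε)
    {n : ℕ} (hn : 0 < n) (x : Fin n → X) (lam : Fin n → ℝ) (hlam : (⨆ l, lam l) = 0)
    (hfar : ∀ y : X, ε ≤ min D (⨆ l, (|lam l| + dist (x l) y)))
    {s : ℕ} (hs : 0 < s) (y : Fin s → X) (α : Fin s → ℝ) (hα : (⨆ i, α i) = 0) :
    ε ≤ min D (⨆ l, (|lam l| + min D (⨆ i, (|α i| + dist (x l) (y i))))) := by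
  let i₀ : Fin s := ⟨0, hs⟩
  refine (hfar (y i₀)).trans (min_le_min le_rfl ?_)
  refine ciSup_mono (Set.finite_range _).bddAbove fun l => ?_
  gcongr
  refine le_min ?_ ?_
  · rw [hD]
    exact Metric.dist_le_diam_of_mem isCompact_univ.isBounded (Set.mem_univ _) (Set.mem_univ _)
  · exact (le_add_of_nonneg_left (abs_nonneg (α i₀))).trans
      (le_ciSup (f := fun i => |α i| + dist (x l) (y i)) (Set.finite_range _).bddAbove i₀)
end
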